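/- arXiv:1207.2313 — 2 statements merged into one kernel-verified Lean document; each statement's English description precedes it below -/
import Mathlib

section
/- Define a sequence (c_n)_{n≥0} of elements of O(Σ_q³(l,−)) by c₀ = 1 and, for n ≥ 1, c_n = x c_{n−1} x* − Σ_{m=1}^{l} (−1)^m q^{−m(m+1)} C(l,m)_{q^{−2}} y c_{n−1} y^{2m−1} z^m. Then for each n there is a polynomial P_n ∈ ℂ[T] with c_n = P_n(y²z), where P₀ = 1 and the polynomials satisfy the recursion P_n(T) = P_{n−1}(q^{2l}T)·∏_{p=0}^{l−1}(1 − q^{2p}T) + P_{n−1}(T)·(1 − ∏_{p=1}^{l}(1 − q^{−2p}T)). (These c_n are the zero-components of the Chern characters of the line bundles Γ[n] over O(ℝP_q²(l;−)).) -/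
/-- The defining relations of `O(Σ_q³(l,−))`: `y* = yz`, `xy = q^l yx`,
`xx* = ∏_{p=0}^{l−1}(1 − q^{2p}y²z)`, `x*x = ∏_{p=1}^{l}(1 − q^{−2p}y²z)`, with `z`
central (it suffices to commute with the generators and their adjoints) and unitary. -/
structure SMinusRels {A : Type} [Ring A] [Algebra ℂ A] [StarRing A] [StarModule ℂ A]
    (q : ℝ) (l : ℕ) (x y z : A) : Prop where
  central_x : z * x = x * z
  central_y : z * y = y * z
  central_xs : z * star x = star x * z
  central_ys : z * star y = star y * z
  unitary : z * star z = 1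
  unitary' : star z * z = 1
  rel_ystar : star y = y * z
  rel_xy : x * y = ((q : ℂ) ^ l) • (y * x)
  rel_xxs : x * star x =
    ((List.range l).map (fun p => 1 - ((q : ℂ) ^ (2 * p)) • (y ^ 2 * z))).prod
  rel_xsx : star x * x =
    ((List.range l).map (fun p => 1 - (((q : ℂ)⁻¹) ^ (2 * (p + 1))) • (y ^ 2 * z))).prod

/-- A presentation of `O(Σ_q³(l,−))`: the *universal* unital complex *-algebra with
generators `x, y` and a central unitary `z` subject to `SMinusRels`. -/
structure SMinusAlg (q : ℝ) (l : ℕ) where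
  A : Type
  [ringA : Ring A]
  [algA : Algebra ℂ A]
  [starA : StarRing A]
  [smodA : StarModule ℂ A]
  x : A
  y : A
  z : A
  rels : SMinusRels q l x y z
  universal : ∀ (B : Type) [Ring B] [Algebra ℂ B] [StarRing B] [StarModule ℂ B]
      (x' y' z' : B), SMinusRels q l x' y' z' →
      ∃! f : A →⋆ₐ[ℂ] B, f x = x' ∧ f y = y' ∧ f z = z'

attribute [instance] SMinusAlg.ringA SMinusAlg.algA SMinusAlg.starA SMinusAlg.smodA

open Polynomial in
/-- Rescaled generating polynomial of the `q`-binomial coefficients with `s = q⁻²`. -/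
theorem prod_one_sub_eq_one_add_sum (q : ℝ) (l : ℕ) (C : ℕ → ℝ)
    (hC : ∀ t : ℝ,
      ∏ k ∈ Finset.range l, (1 + (q⁻¹ ^ 2) ^ k * t) =
        ∑ m ∈ Finset.range (l + 1), (q⁻¹ ^ 2) ^ (m * (m - 1) / 2) * C m * t ^ m) :
    ∏ p ∈ Finset.range l, (1 - Polynomial.C (((q : ℂ)⁻¹) ^ (2 * (p + 1))) * X) =
      1 + ∑ m ∈ Finset.Icc 1 l,
        Polynomial.C ((((-1 : ℝ) ^ m * q⁻¹ ^ (m * (m + 1)) * C m : ℝ) : ℂ)) * X ^ m := by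
  have hC0 : C 0 = 1 := by
    have h := hC 0
    rw [Finset.sum_range_succ'] at h
    simpa using h.symm
  have hreal : ∏ p ∈ Finset.range l, (1 - Polynomial.C ((q⁻¹) ^ (2 * (p + 1))) * X) =
      1 + ∑ m ∈ Finset.Icc 1 l,
        Polynomial.C ((-1 : ℝ) ^ m * q⁻¹ ^ (m * (m + 1)) * C m) * X ^ m := by
    refine Polynomial.funext fun t => ?_
    have h := hC (-(q⁻¹ ^ 2 * t))
    rw [Finset.range_eq_Ico, Finset.range_eq_Ico, Finset.sum_eq_sum_Ico_succ_bot (by simp),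
      ← Finset.range_eq_Ico] at h
    simp only [eval_prod, eval_sub, eval_one, eval_mul, eval_C, eval_X, eval_add,
      eval_finsetSum, eval_pow]
    calc _ = ∏ k ∈ Finset.range l, (1 + (q⁻¹ ^ 2) ^ k * -(q⁻¹ ^ 2 * t)) := by
          refine Finset.prod_congr rfl fun p _ => ?_
          ring
      _ = _ := by
          rw [h]
          congr 1
          · simp [hC0]
          · refine Finset.sum_congr rfl fun m _ => ?_
            have hm : m * (m + 1) = 2 * (m * (m - 1) / 2) + 2 * m := by
              rw [Nat.mul_div_cancel' (Nat.even_mul_pred_self m).two_dvd]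
              cases m with
              | zero => rfl
              | succ k => simp only [Nat.add_sub_cancel]; ring
            rw [hm, pow_add, pow_mul, pow_mul, neg_pow (q⁻¹ ^ 2 * t), mul_pow]
            ring
  have h := congrArg (Polynomial.map Complex.ofRealHom) hreal
  simpa [Polynomial.map_prod, Polynomial.map_sum] using h

open Polynomial in
/-- If `x` and `T` commute up to the scalar `a`, moving `x` across `P(T)` rescales the argument. -/
theorem mul_aeval_eq_aeval_comp_mul {A : Type*} [Ring A] [Algebra ℂ A] {x T : A} {a : ℂ}
    (h : x * T = a • (T * x)) (P : ℂ[X]) :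
    x * aeval T P = aeval T (P.comp (Polynomial.C a * X)) * x := by
  have hs : SemiconjBy x T (a • T) := by
    rw [SemiconjBy, h, smul_mul_assoc]
  have hcomp : aeval T (P.comp (Polynomial.C a * X)) = aeval (a • T) P := by
    rw [aeval_comp]
    simp [Algebra.smul_def]
  rw [hcomp]
  clear hcomp
  induction P using Polynomial.induction_on' with
  | add p r hp hr => simp only [map_add, mul_add, add_mul, hp, hr]
  | monomial n c =>
    rw [aeval_monomial, aeval_monomial, ← mul_assoc, ← Algebra.commutes c x, mul_assoc,
      (hs.pow_right n).eq, mul_assoc]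

open Polynomial in
/-- The product over a list of linear expressions in `T` as the value of a polynomial. -/
theorem list_prod_one_sub_smul_eq_aeval {A : Type*} [Ring A] [Algebra ℂ A] (T : A) (a : ℕ → ℂ)
    (l : ℕ) :
    ((List.range l).map fun p => 1 - a p • T).prod =
      aeval T (∏ p ∈ Finset.range l, (1 - Polynomial.C (a p) * X)) := by
  induction l with
  | zero => simp
  | succ k ih =>
    rw [List.range_succ, Finset.prod_range_succ, map_mul, ← ih]
    simp [Algebra.smul_def]

/-- The polynomials `P_n` determined by the recursion for the Chern characters. -/
noncomputable def chernPolynomial (q : ℝ) (l : ℕ) : ℕ → Polynomial ℂ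
  | 0 => 1
  | n + 1 =>
    (chernPolynomial q l n).comp (Polynomial.C ((q : ℂ) ^ (2 * l)) * Polynomial.X) *
        (∏ p ∈ Finset.range l, (1 - Polynomial.C ((q : ℂ) ^ (2 * p)) * Polynomial.X)) +
      chernPolynomial q l n *
        (1 - ∏ p ∈ Finset.range l,
          (1 - Polynomial.C (((q : ℂ)⁻¹) ^ (2 * (p + 1))) * Polynomial.X))

/-- define `c₀ = 1` and, for `n ≥ 1`,
`c_n = x c_{n−1} x* − Σ_{m=1}^{l} (−1)^m q^{−m(m+1)} C(l,m)_{q^{−2}} y c_{n−1} y^{2m−1} z^m`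
in `O(Σ_q³(l,−))`, where the `q`-binomial coefficients `C(l,m)_{q^{−2}}` (given as the
family `C`) satisfy `∏_{m=1}^{l}(1 + s^{m−1}t) = Σ_{m=0}^{l} s^{m(m−1)/2} C(l,m)_s t^m`
with `s = q^{−2}`.  Then for each `n` there is a polynomial `P_n ∈ ℂ[T]` with
`c_n = P_n(y²z)`, where `P₀ = 1` and
`P_n(T) = P_{n−1}(q^{2l}T)·∏_{p=0}^{l−1}(1 − q^{2p}T) + P_{n−1}(T)·(1 − ∏_{p=1}^{l}(1 − q^{−2p}T))`.
(These `c_n` are the zero-components of the Chern characters of the line bundles `Γ[n]`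
over `O(ℝP_q²(l;−))`.) -/
theorem sminus_chern_character_polynomials (q : ℝ) (hq0 : 0 < q) (hq1 : q < 1)
    (l : ℕ) (hl : 0 < l) (Pm : SMinusAlg q l)
    (C : ℕ → ℝ)
    (hC : ∀ t : ℝ,
      ∏ k ∈ Finset.range l, (1 + (q⁻¹ ^ 2) ^ k * t) =
        ∑ m ∈ Finset.range (l + 1), (q⁻¹ ^ 2) ^ (m * (m - 1) / 2) * C m * t ^ m)
    (c : ℕ → Pm.A)
    (hc0 : c 0 = 1)
    (hcrec : ∀ n : ℕ,
      c (n + 1) =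
        Pm.x * c n * star Pm.x -
          ∑ m ∈ Finset.Icc 1 l,
            ((((-1 : ℝ) ^ m * q⁻¹ ^ (m * (m + 1)) * C m : ℝ) : ℂ) •
              (Pm.y * c n * (Pm.y ^ (2 * m - 1) * Pm.z ^ m)))) :
    ∃ P : ℕ → Polynomial ℂ,
      P 0 = 1 ∧
      (∀ n : ℕ,
        P (n + 1) =
          (P n).comp (Polynomial.C ((q : ℂ) ^ (2 * l)) * Polynomial.X) *
              (∏ p ∈ Finset.range l,
                (1 - Polynomial.C ((q : ℂ) ^ (2 * p)) * Polynomial.X)) +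
            P n *
              (1 - ∏ p ∈ Finset.range l,
                (1 - Polynomial.C (((q : ℂ)⁻¹) ^ (2 * (p + 1))) * Polynomial.X))) ∧
      (∀ n : ℕ, c n = Polynomial.aeval (Pm.y ^ 2 * Pm.z) (P n)) := by
  have hr := Pm.rels
  have hzx : Commute Pm.x Pm.z := hr.central_x.symm
  have hzy : Commute Pm.y Pm.z := hr.central_y.symm
  have hxT : Pm.x * (Pm.y ^ 2 * Pm.z) =
      ((q : ℂ) ^ (2 * l)) • ((Pm.y ^ 2 * Pm.z) * Pm.x) := by
    have hxy : SemiconjBy Pm.x Pm.y (((q : ℂ) ^ l) • Pm.y) := by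
      rw [SemiconjBy, hr.rel_xy, smul_mul_assoc]
    have hxT := (hxy.pow_right 2).mul_right hzx
    rw [SemiconjBy] at hxT
    rw [hxT, smul_pow, smul_mul_assoc, smul_mul_assoc, ← pow_mul, mul_comm l 2]
  have hyT : Commute Pm.y (Pm.y ^ 2 * Pm.z) :=
    ((Commute.refl Pm.y).pow_right 2).mul_right hzy
  refine ⟨chernPolynomial q l, rfl, fun _ => rfl, fun n => ?_⟩
  induction n with
  | zero => simp [hc0, chernPolynomial]
  | succ n ih =>
    have hyP : Commute Pm.y (Polynomial.aeval (Pm.y ^ 2 * Pm.z) (chernPolynomial q l n)) := by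
      have h := mul_aeval_eq_aeval_comp_mul (hyT.eq.trans (one_smul ℂ _).symm)
        (chernPolynomial q l n)
      simpa [Commute, SemiconjBy] using h
    have hpow : ∀ m ∈ Finset.Icc 1 l,
        Pm.y * (Pm.y ^ (2 * m - 1) * Pm.z ^ m) = (Pm.y ^ 2 * Pm.z) ^ m := by
      intro m hm
      have hm1 : 1 ≤ m := (Finset.mem_Icc.mp hm).1
      rw [(hzy.pow_left 2).mul_pow, ← mul_assoc, ← pow_succ', ← pow_mul]
      congr 2
      omega
    rw [hcrec, ih, mul_aeval_eq_aeval_comp_mul hxT, mul_assoc, hr.rel_xxs,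
      list_prod_one_sub_smul_eq_aeval, chernPolynomial,
      prod_one_sub_eq_one_add_sum q l C hC, map_add, map_mul, map_mul, sub_eq_add_neg]
    congr 1
    rw [sub_add_cancel_left, map_neg, mul_neg, map_sum, Finset.mul_sum]
    congr 1
    refine Finset.sum_congr rfl fun m hm => ?_
    rw [hyP.eq, mul_assoc (Polynomial.aeval _ _), hpow m hm, map_mul, map_pow, Polynomial.aeval_X, Polynomial.aeval_C,
      ← Algebra.smul_def, mul_smul_comm]
end

section
/- Let O(ℝP_q²(l;−)) be the coordinate algebra of the quantum real weighted projective space and fix r ∈ {1,…,l}. Let (e_n)_{n∈ℕ} be the standard orthonormal basis of the Hilbert space ℓ²(ℕ). Then the formulas π_r(a)e_n = q^{2(ln+r)} e_n, π_r(b)e_n = q^{ln+r} ∏_{m=1}^{l}(1 − q^{2(ln+r−m)})^{1/2} e_{n−1} (with π_r(b)e₀ = 0), and π_r(c₋)e_n = ∏_{m=1}^{2l}(1 − q^{2(ln+r−m)})^{1/2} e_{n−2} (with π_r(c₋)e₀ = π_r(c₋)e₁ = 0) extend to a unital *-algebra homomorphism π_r from O(ℝP_q²(l;−)) to the algebra of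 bounded linear operators on ℓ²(ℕ). -/
/-- The defining relations of the coordinate *-algebra `O(ℝP_q²(l;−))` of the quantum
real weighted projective space: `a = a*`, `ab = q^{−2l}ba`, `ac₋ = q^{−4l}c₋a`,
`b² = q^{3l}ac₋`, `bc₋ = q^{−2l}c₋b`, `bb* = q^{2l} a ∏_{m=0}^{l−1}(1 − q^{2m}a)`,
`b*b = a ∏_{m=1}^{l}(1 − q^{−2m}a)`, `b*c₋ = q^{−l} ∏_{m=1}^{l}(1 − q^{−2m}a) b`,
`c₋b* = q^{l} b ∏_{m=0}^{l−1}(1 − q^{2m}a)`, `c₋c₋* = ∏_{m=0}^{2l−1}(1 − q^{2m}a)`,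
`c₋*c₋ = ∏_{m=1}^{2l}(1 − q^{−2m}a)`. -/
structure RPMinusRels {A : Type} [Ring A] [Algebra ℂ A] [StarRing A] [StarModule ℂ A]
    (q : ℝ) (l : ℕ) (a b c : A) : Prop where
  rel_sa : star a = a
  rel_ab : a * b = (((q : ℂ)⁻¹) ^ (2 * l)) • (b * a)
  rel_ac : a * c = (((q : ℂ)⁻¹) ^ (4 * l)) • (c * a)
  rel_bb : b ^ 2 = ((q : ℂ) ^ (3 * l)) • (a * c)
  rel_bc : b * c = (((q : ℂ)⁻¹) ^ (2 * l)) • (c * b)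
  rel_bbs : b * star b =
    ((q : ℂ) ^ (2 * l)) •
      (a * ((List.range l).map (fun m => 1 - ((q : ℂ) ^ (2 * m)) • a)).prod)
  rel_bsb : star b * b =
    a * ((List.range l).map (fun m => 1 - (((q : ℂ)⁻¹) ^ (2 * (m + 1))) • a)).prod
  rel_bsc : star b * c =
    (((q : ℂ)⁻¹) ^ l) •
      (((List.range l).map (fun m => 1 - (((q : ℂ)⁻¹) ^ (2 * (m + 1))) • a)).prod * b)
  rel_cbs : c * star b =
    ((q : ℂ) ^ l) •
      (b * ((List.range l).map (fun m => 1 - ((q : ℂ) ^ (2 * m)) • a)).prod)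
  rel_ccs : c * star c =
    ((List.range (2 * l)).map (fun m => 1 - ((q : ℂ) ^ (2 * m)) • a)).prod
  rel_csc : star c * c =
    ((List.range (2 * l)).map (fun m => 1 - (((q : ℂ)⁻¹) ^ (2 * (m + 1))) • a)).prod

/-- A presentation of `O(ℝP_q²(l;−))`: the *universal* unital complex *-algebra with
generators `a, b, c₋` subject to `RPMinusRels`. -/
structure RPMinusAlg (q : ℝ) (l : ℕ) where
  A : Type
  [ringA : Ring A]
  [algA : Algebra ℂ A]
  [starA : StarRing A]
  [smodA : StarModule ℂ A]
  a : A
  b : A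
  c : A
  rels : RPMinusRels q l a b c
  universal : ∀ (B : Type) [Ring B] [Algebra ℂ B] [StarRing B] [StarModule ℂ B]
      (a' b' c' : B), RPMinusRels q l a' b' c' →
      ∃! f : A →⋆ₐ[ℂ] B, f a = a' ∧ f b = b' ∧ f c = c'

attribute [instance] RPMinusAlg.ringA RPMinusAlg.algA RPMinusAlg.starA RPMinusAlg.smodA

/-- The weighted backward shift `e_{n+k} ↦ w n • e_n` on `ℓ²(ℕ)`, for weights bounded by one. -/
noncomputable def weightedBackwardShift (k : ℕ) (w : ℕ → ℝ) (hw : ∀ n, |w n| ≤ 1) :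
    (lp (fun _ : ℕ => ℂ) 2) →L[ℂ] (lp (fun _ : ℕ => ℂ) 2) :=
  have hbd : ∀ (f : lp (fun _ : ℕ => ℂ) 2) (n : ℕ),
      ‖(w n : ℂ) * f (n + k)‖ ^ (2 : ENNReal).toReal ≤ ‖f (n + k)‖ ^ (2 : ENNReal).toReal := by
    intro f n
    refine Real.rpow_le_rpow (norm_nonneg _) ?_ (by simp)
    rw [norm_mul, Complex.norm_real, Real.norm_eq_abs]
    exact mul_le_of_le_one_left (norm_nonneg _) (hw n)
  have hinj : Function.Injective fun n : ℕ => n + k := add_left_injective k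
  have hsum : ∀ f : lp (fun _ : ℕ => ℂ) 2,
      Summable fun n => ‖f n‖ ^ (2 : ENNReal).toReal := fun f =>
    (lp.memℓp f).summable (by simp)
  have hsum' : ∀ f : lp (fun _ : ℕ => ℂ) 2,
      Summable fun n => ‖(w n : ℂ) * f (n + k)‖ ^ (2 : ENNReal).toReal := fun f =>
    Summable.of_nonneg_of_le (fun n => by positivity) (hbd f) ((hsum f).comp_injective hinj)
  LinearMap.mkContinuous
    { toFun := fun f => ⟨fun n => (w n : ℂ) * f (n + k), memℓp_gen (hsum' f)⟩
      map_add' := fun f g => by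
        ext n
        simp only [lp.coeFn_add, Pi.add_apply, mul_add]
      map_smul' := fun z f => by
        ext n
        simp only [lp.coeFn_smul, Pi.smul_apply, smul_eq_mul, mul_left_comm, RingHom.id_apply] } 1 (fun f => by
      rw [one_mul]
      refine lp.norm_le_of_tsum_le (by simp) (norm_nonneg f) ?_
      rw [lp.norm_rpow_eq_tsum (by simp) f]
      refine ((hsum' f).tsum_le_tsum (hbd f) ((hsum f).comp_injective hinj)).trans ?_
      exact tsum_comp_le_tsum_of_inj (hsum f) (fun n => by positivity) hinj)

theorem weightedBackwardShift_apply (k : ℕ) (w : ℕ → ℝ) (hw : ∀ n, |w n| ≤ 1)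
    (f : lp (fun _ : ℕ => ℂ) 2) (n : ℕ) :
    weightedBackwardShift k w hw f n = (w n : ℂ) * f (n + k) := rfl

theorem weightedBackwardShift_single_add (k : ℕ) (w : ℕ → ℝ) (hw : ∀ n, |w n| ≤ 1) (n : ℕ) :
    weightedBackwardShift k w hw (lp.single 2 (n + k) (1 : ℂ)) =
      (w n : ℂ) • lp.single 2 n (1 : ℂ) := by
  ext m
  rw [weightedBackwardShift_apply, lp.coeFn_smul, Pi.smul_apply, smul_eq_mul]
  by_cases h : m = n
  · subst h
    simp
  · simp [lp.single_apply, h]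

theorem weightedBackwardShift_single_of_lt (k : ℕ) (w : ℕ → ℝ) (hw : ∀ n, |w n| ≤ 1) {n : ℕ}
    (hn : n < k) : weightedBackwardShift k w hw (lp.single 2 n (1 : ℂ)) = 0 := by
  ext m
  rw [weightedBackwardShift_apply]
  have h : m + k ≠ n := by omega
  simp [lp.single_apply, h]

theorem star_apply_eq_inner (T : (lp (fun _ : ℕ => ℂ) 2) →L[ℂ] (lp (fun _ : ℕ => ℂ) 2))
    (f : lp (fun _ : ℕ => ℂ) 2) (n : ℕ) :
    star T f n = inner ℂ (T (lp.single 2 n (1 : ℂ))) f := by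
  rw [← ContinuousLinearMap.adjoint_inner_right, lp.inner_single_left]
  simp [ContinuousLinearMap.star_eq_adjoint]

theorem star_weightedBackwardShift_apply_add (k : ℕ) (w : ℕ → ℝ) (hw : ∀ n, |w n| ≤ 1)
    (f : lp (fun _ : ℕ => ℂ) 2) (n : ℕ) :
    star (weightedBackwardShift k w hw) f (n + k) = (w n : ℂ) * f n := by
  rw [star_apply_eq_inner, weightedBackwardShift_single_add, inner_smul_left,
    lp.inner_single_left]
  simp

theorem star_weightedBackwardShift_apply_of_lt (k : ℕ) (w : ℕ → ℝ) (hw : ∀ n, |w n| ≤ 1)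
    (f : lp (fun _ : ℕ => ℂ) 2) {n : ℕ} (hn : n < k) :
    star (weightedBackwardShift k w hw) f n = 0 := by
  rw [star_apply_eq_inner, weightedBackwardShift_single_of_lt k w hw hn, inner_zero_left]

theorem prod_one_sub_smul_apply {T : (lp (fun _ : ℕ => ℂ) 2) →L[ℂ] (lp (fun _ : ℕ => ℂ) 2)}
    {x : ℕ → ℂ} (hT : ∀ f n, T f n = x n * f n) (s : ℕ → ℂ) (N : ℕ)
    (f : lp (fun _ : ℕ => ℂ) 2) (n : ℕ) :
    ((List.range N).map (fun m => 1 - s m • T)).prod f n =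
      (∏ m ∈ Finset.range N, (1 - s m * x n)) * f n := by
  induction N generalizing f with
  | zero => simp
  | succ N ih =>
    rw [List.range_succ, List.map_append, List.prod_append, mul_apply_eq_comp, ih,
      Finset.prod_range_succ]
    simp only [List.map_singleton, List.prod_singleton, sub_apply, smul_apply, one_apply_eq_self,
      lp.coeFn_sub, lp.coeFn_smul, Pi.sub_apply, Pi.smul_apply, smul_eq_mul, hT]
    ring

/-- The product `∏_{j<l} (1 - q^{2(K+j)})^{1/2}`. -/
noncomputable def sqrtProd (q : ℝ) (K l : ℕ) : ℝ :=
  ∏ j ∈ Finset.range l, Real.sqrt (1 - q ^ (2 * (K + j)))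

theorem sqrtProd_nonneg (q : ℝ) (K l : ℕ) : 0 ≤ sqrtProd q K l :=
  Finset.prod_nonneg fun _ _ => Real.sqrt_nonneg _

theorem sqrtProd_le_one {q : ℝ} (hq0 : 0 < q) (K l : ℕ) : sqrtProd q K l ≤ 1 :=
  Finset.prod_le_one (fun _ _ => Real.sqrt_nonneg _) fun j _ => by
    rw [Real.sqrt_le_one]
    have : 0 < q ^ (2 * (K + j)) := by positivity
    linarith

theorem sqrtProd_add (q : ℝ) (K l l' : ℕ) :
    sqrtProd q K (l + l') = sqrtProd q K l * sqrtProd q (K + l) l' := by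
  simp only [sqrtProd, Finset.prod_range_add, add_assoc]

theorem prod_Icc_sqrt_eq_sqrtProd (q : ℝ) (K l : ℕ) :
    ∏ m ∈ Finset.Icc 1 l, Real.sqrt (1 - q ^ (2 * (K + l - m))) = sqrtProd q K l := by
  rw [sqrtProd, ← Finset.prod_range_reflect, Finset.range_eq_Ico,
    ← Finset.Ico_add_one_right_eq_Icc, ← Finset.prod_Ico_add' _ 0 l 1]
  refine Finset.prod_congr rfl fun j hj => ?_
  rw [Finset.mem_Ico] at hj
  congr 4
  omega

theorem sqrtProd_sq {q : ℝ} (hq0 : 0 < q) (hq1 : q < 1) (K l : ℕ) :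
    sqrtProd q K l ^ 2 = ∏ j ∈ Finset.range l, (1 - q ^ (2 * (K + j))) := by
  rw [sqrtProd, ← Finset.prod_pow]
  refine Finset.prod_congr rfl fun j _ => Real.sq_sqrt ?_
  exact sub_nonneg.2 (pow_le_one₀ hq0.le hq1.le)

theorem prod_one_sub_pow_mul {q : ℝ} (hq0 : 0 < q) (hq1 : q < 1) (K l : ℕ) :
    ∏ m ∈ Finset.range l, (1 - (q : ℂ) ^ (2 * m) * ((q ^ (2 * K) : ℝ) : ℂ)) =
      (sqrtProd q K l : ℂ) ^ 2 := by
  rw [← Complex.ofReal_pow, sqrtProd_sq hq0 hq1]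
  push_cast
  refine Finset.prod_congr rfl fun j _ => ?_
  ring

theorem prod_one_sub_inv_pow_mul {q : ℝ} (hq0 : 0 < q) (hq1 : q < 1) (K l : ℕ) :
    ∏ m ∈ Finset.range l, (1 - (q : ℂ)⁻¹ ^ (2 * (m + 1)) * ((q ^ (2 * (K + l)) : ℝ) : ℂ)) =
      (sqrtProd q K l : ℂ) ^ 2 := by
  have hq : (q : ℂ) ≠ 0 := by exact_mod_cast hq0.ne'
  rw [← Complex.ofReal_pow, sqrtProd_sq hq0 hq1, ← Finset.prod_range_reflect]
  push_cast
  refine Finset.prod_congr rfl fun j hj => ?_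
  rw [Finset.mem_range] at hj
  have h : 2 * (K + l) = 2 * (l - 1 - j + 1) + 2 * (K + j) := by omega
  rw [h, pow_add, ← mul_assoc, ← mul_pow, inv_mul_cancel₀ hq, one_pow, one_mul]

theorem prod_one_sub_inv_pow_mul_eq_zero {q : ℝ} (hq0 : 0 < q) {K l : ℕ} (hK : 1 ≤ K)
    (hKl : K ≤ l) :
    ∏ m ∈ Finset.range l, (1 - (q : ℂ)⁻¹ ^ (2 * (m + 1)) * ((q ^ (2 * K) : ℝ) : ℂ)) = 0 := by
  have hq : (q : ℂ) ≠ 0 := by exact_mod_cast hq0.ne'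
  refine Finset.prod_eq_zero (Finset.mem_range.2 (show K - 1 < l by omega)) ?_
  rw [Nat.sub_add_cancel hK, Complex.ofReal_pow, ← mul_pow, inv_mul_cancel₀ hq, one_pow, sub_self]

theorem abs_le_one_of_mem {x : ℝ} (h0 : 0 ≤ x) (h1 : x ≤ 1) : |x| ≤ 1 := by
  rwa [abs_of_nonneg h0]

/-- fix `r ∈ {1,…,l}` and let `(e_n)_{n∈ℕ}` be the standard orthonormal
basis of `ℓ²(ℕ)`.  The formulas `π_r(a)e_n = q^{2(ln+r)}e_n`,
`π_r(b)e_n = q^{ln+r}∏_{m=1}^{l}(1 − q^{2(ln+r−m)})^{1/2} e_{n−1}` (with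
`π_r(b)e₀ = 0`) and `π_r(c₋)e_n = ∏_{m=1}^{2l}(1 − q^{2(ln+r−m)})^{1/2} e_{n−2}` (with
`π_r(c₋)e₀ = π_r(c₋)e₁ = 0`) extend to a unital *-algebra homomorphism `π_r` from
`O(ℝP_q²(l;−))` to the bounded linear operators on `ℓ²(ℕ)`. -/
theorem rpminus_infinite_dimensional_representation (q : ℝ) (hq0 : 0 < q) (hq1 : q < 1)
    (l : ℕ) (hl : 0 < l) (r : ℕ) (hr1 : 1 ≤ r) (hrl : r ≤ l) (Pm : RPMinusAlg q l) :
    ∃ π : Pm.A →⋆ₐ[ℂ] ((lp (fun _ : ℕ => ℂ) 2) →L[ℂ] (lp (fun _ : ℕ => ℂ) 2)),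
      (∀ n : ℕ,
        (π Pm.a) (lp.single 2 n (1 : ℂ)) =
          (((q ^ (2 * (l * n + r)) : ℝ) : ℂ)) • lp.single 2 n (1 : ℂ)) ∧
      (∀ n : ℕ,
        (π Pm.b) (lp.single 2 (n + 1) (1 : ℂ)) =
          (((q ^ (l * (n + 1) + r) *
              ∏ m ∈ Finset.Icc 1 l,
                Real.sqrt (1 - q ^ (2 * (l * (n + 1) + r - m))) : ℝ) : ℂ)) •
            lp.single 2 n (1 : ℂ)) ∧
      (π Pm.b) (lp.single 2 0 (1 : ℂ)) = 0 ∧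
      (∀ n : ℕ,
        (π Pm.c) (lp.single 2 (n + 2) (1 : ℂ)) =
          (((∏ m ∈ Finset.Icc 1 (2 * l),
              Real.sqrt (1 - q ^ (2 * (l * (n + 2) + r - m))) : ℝ) : ℂ)) •
            lp.single 2 n (1 : ℂ)) ∧
      (π Pm.c) (lp.single 2 0 (1 : ℂ)) = 0 ∧
      (π Pm.c) (lp.single 2 1 (1 : ℂ)) = 0 := by
  have hq : (q : ℂ) ≠ 0 := by exact_mod_cast hq0.ne'
  have hwa : ∀ n, |q ^ (2 * (l * n + r))| ≤ 1 := fun n =>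
    abs_le_one_of_mem (by positivity) (pow_le_one₀ hq0.le hq1.le)
  have hwb : ∀ n, |q ^ (l * (n + 1) + r) * sqrtProd q (l * n + r) l| ≤ 1 := fun n =>
    abs_le_one_of_mem (mul_nonneg (by positivity) (sqrtProd_nonneg _ _ _))
      (mul_le_one₀ (pow_le_one₀ hq0.le hq1.le) (sqrtProd_nonneg _ _ _) (sqrtProd_le_one hq0 _ _))
  have hwc : ∀ n, |sqrtProd q (l * n + r) (2 * l)| ≤ 1 := fun n =>
    abs_le_one_of_mem (sqrtProd_nonneg _ _ _) (sqrtProd_le_one hq0 _ _)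
  have hrels : RPMinusRels q l (weightedBackwardShift 0 _ hwa) (weightedBackwardShift 1 _ hwb)
      (weightedBackwardShift 2 _ hwc) := by
    have ha := weightedBackwardShift_apply 0 _ hwa
    have hb := weightedBackwardShift_apply 1 _ hwb
    have hc := weightedBackwardShift_apply 2 _ hwc
    have hsa := star_weightedBackwardShift_apply_add 0 _ hwa
    have hsb := star_weightedBackwardShift_apply_add 1 _ hwb
    have hsc := star_weightedBackwardShift_apply_add 2 _ hwc
    have hsb0 := fun f => star_weightedBackwardShift_apply_of_lt 1 _ hwb f one_pos
    have hsc0 := fun f => star_weightedBackwardShift_apply_of_lt 2 _ hwc f two_pos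
    have hsc1 := fun f => star_weightedBackwardShift_apply_of_lt 2 _ hwc f one_lt_two
    have hp := prod_one_sub_smul_apply ha
    set a := weightedBackwardShift 0 _ hwa
    set b := weightedBackwardShift 1 _ hwb
    set c := weightedBackwardShift 2 _ hwc
    have hC : ∀ n, sqrtProd q (l * n + r) (2 * l) =
        sqrtProd q (l * n + r) l * sqrtProd q (l * (n + 1) + r) l := fun n => by
      rw [two_mul, sqrtProd_add]
      congr 2
      ring
    have hx : ∀ n, l * (n + 1) + r = l * n + r + l := fun n => by ring
    have hx2 : ∀ n, l * (n + 2) + r = l * n + r + 2 * l := fun n => by ring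
    have hP := fun n => prod_one_sub_pow_mul hq0 hq1 (l * n + r) l
    have hP2 := fun n => prod_one_sub_pow_mul hq0 hq1 (l * n + r) (2 * l)
    have hM := fun n => prod_one_sub_inv_pow_mul hq0 hq1 (l * n + r) l
    have hM2 := fun n => prod_one_sub_inv_pow_mul hq0 hq1 (l * n + r) (2 * l)
    simp only [← hx] at hM
    simp only [← hx2] at hM2
    have hM0 : ∏ m ∈ Finset.range l,
        (1 - (q : ℂ)⁻¹ ^ (2 * (m + 1)) * ((q ^ (2 * (l * 0 + r)) : ℝ) : ℂ)) = 0 :=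
      prod_one_sub_inv_pow_mul_eq_zero hq0 (by omega) (by omega)
    have hM20 : ∏ m ∈ Finset.range (2 * l),
        (1 - (q : ℂ)⁻¹ ^ (2 * (m + 1)) * ((q ^ (2 * (l * 0 + r)) : ℝ) : ℂ)) = 0 :=
      prod_one_sub_inv_pow_mul_eq_zero hq0 (by omega) (by omega)
    have hM21 : ∏ m ∈ Finset.range (2 * l),
        (1 - (q : ℂ)⁻¹ ^ (2 * (m + 1)) * ((q ^ (2 * (l * 1 + r)) : ℝ) : ℂ)) = 0 :=
      prod_one_sub_inv_pow_mul_eq_zero hq0 (by omega) (by omega)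
    constructor
    case rel_sa =>
      ext f n
      exact (hsa f n).trans (ha f n).symm
    case rel_ab =>
      ext f n
      simp only [mul_apply_eq_comp, smul_apply, lp.coeFn_smul,
        Pi.smul_apply, smul_eq_mul, ha, hb, add_zero]
      rw [inv_pow, eq_inv_mul_iff_mul_eq₀ (pow_ne_zero _ hq)]
      push_cast
      ring_nf
    case rel_ac =>
      ext f n
      simp only [mul_apply_eq_comp, smul_apply, lp.coeFn_smul,
        Pi.smul_apply, smul_eq_mul, ha, hc, add_zero]
      rw [inv_pow, eq_inv_mul_iff_mul_eq₀ (pow_ne_zero _ hq)]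
      push_cast
      ring_nf
    case rel_bb =>
      ext f n
      simp only [pow_two b, mul_apply_eq_comp, smul_apply,
        lp.coeFn_smul, Pi.smul_apply, smul_eq_mul, ha, hb, hc, hC, add_zero]
      push_cast
      ring
    case rel_bc =>
      ext f n
      simp only [mul_apply_eq_comp, smul_apply,
        lp.coeFn_smul, Pi.smul_apply, smul_eq_mul, hb, hc, hC]
      rw [inv_pow, eq_inv_mul_iff_mul_eq₀ (pow_ne_zero _ hq)]
      push_cast
      ring_nf
    case rel_bbs =>
      ext f n
      simp only [mul_apply_eq_comp, smul_apply,
        lp.coeFn_smul, Pi.smul_apply, smul_eq_mul, ha, hb, hsb, hp, hP, add_zero]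
      push_cast
      ring
    case rel_bsb =>
      ext f n
      rcases n with _ | n
      · simp only [mul_apply_eq_comp, ha, hsb0, hp, hM0, zero_mul]
        exact (mul_zero _).symm
      · simp only [mul_apply_eq_comp, ha, hb, hsb, hp, hM, add_zero]
        push_cast
        ring
    case rel_bsc =>
      ext f n
      rcases n with _ | n
      · simp only [mul_apply_eq_comp, smul_apply,
          lp.coeFn_smul, Pi.smul_apply, smul_eq_mul, hsb0, hp, hM0, zero_mul]
        exact (mul_zero _).symm
      · simp only [mul_apply_eq_comp, smul_apply,
          lp.coeFn_smul, Pi.smul_apply, smul_eq_mul, hb, hc, hsb, hp, hM, hC]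
        rw [inv_pow, eq_inv_mul_iff_mul_eq₀ (pow_ne_zero _ hq)]
        push_cast
        ring_nf
    case rel_cbs =>
      ext f n
      simp only [mul_apply_eq_comp, smul_apply,
        lp.coeFn_smul, Pi.smul_apply, smul_eq_mul, hb, hc, hsb, hp, hP, hC]
      push_cast
      ring
    case rel_ccs =>
      ext f n
      simp only [mul_apply_eq_comp, hc, hsc, hp, hP2]
      ring
    case rel_csc =>
      ext f n
      rcases n with _ | _ | n
      · simp only [mul_apply_eq_comp, hsc0, hp, hM20, zero_mul]
      · simp only [mul_apply_eq_comp, zero_add, hsc1, hp, hM21, zero_mul]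
      · rw [show n + 1 + 1 = n + 2 from rfl]
        simp only [mul_apply_eq_comp, hc, hsc, hp, hM2]
        ring
  obtain ⟨π, ⟨ha, hb, hc⟩, -⟩ := Pm.universal _ _ _ _ hrels
  refine ⟨π, ?_, ?_, ?_, ?_, ?_, ?_⟩
  · intro n
    rw [ha]
    exact weightedBackwardShift_single_add 0 _ hwa n
  · intro n
    rw [hb, weightedBackwardShift_single_add, ← prod_Icc_sqrt_eq_sqrtProd,
      show l * n + r + l = l * (n + 1) + r by ring]
  · rw [hb, weightedBackwardShift_single_of_lt _ _ _ one_pos]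
  · intro n
    rw [hc, weightedBackwardShift_single_add, ← prod_Icc_sqrt_eq_sqrtProd,
      show l * n + r + 2 * l = l * (n + 2) + r by ring]
  · rw [hc, weightedBackwardShift_single_of_lt _ _ _ two_pos]
  · rw [hc, weightedBackwardShift_single_of_lt _ _ _ one_lt_two]
end
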